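/- Let k, ℓ ∈ ℕ, ε > 0, and let V be a finite set of size n with n ≥ 2k ≥ 2ℓ. If f : C(V,k) → ℝ satisfies max_{ℓ≤r≤k} W^r(f) ≤ ε, then there exists a function f̃ : C(V,k) → ℝ such that: (i) for all but at most 5^{k/2} ε^{1/2} C(n,k) sets R ∈ C(V,k), one has |f(R) − f̃(R)| ≤ ε^{1/2}; and (ii) W^k(f̃) = W^{k−1}(f̃) = ⋯ = W^ℓ(f̃) = 0. -/

import Mathlib

open Finset

/-- Inner signed average over k-subsets R crossing each pair {a i, b i}:
E_R [ (-1)^{|R ∩ {b_1,...,b_r}|} f(R) ]. -/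
noncomputable def signedAvg {V : Type*} [Fintype V] [DecidableEq V] (k : ℕ) {r : ℕ}
    (f : Finset V → ℝ) (a b : Fin r → V) : ℝ :=
  (∑ R ∈ (Finset.univ.powersetCard k).filter
      (fun R => ∀ i, (R ∩ {a i, b i}).card = 1),
      (-1 : ℝ) ^ (R ∩ Finset.image b Finset.univ).card * f R) /
  (((Finset.univ.powersetCard k).filter
      (fun R => ∀ i, (R ∩ {a i, b i}).card = 1)).card)

/-- The level-r weight W^r(f) of a function on k-subsets: the square root of the
average, over all sequences (a_1,b_1,...,a_r,b_r) of 2r distinct vertices, of the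
square of the inner signed average. -/
noncomputable def Wpow {V : Type*} [Fintype V] [DecidableEq V] (k r : ℕ)
    (f : Finset V → ℝ) : ℝ :=
  Real.sqrt
    ((∑ p ∈ (Finset.univ : Finset ((Fin r → V) × (Fin r → V))).filter
        (fun p => Function.Injective (Sum.elim p.1 p.2)),
        (signedAvg k f p.1 p.2) ^ 2) /
      (((Finset.univ : Finset ((Fin r → V) × (Fin r → V))).filter
        (fun p => Function.Injective (Sum.elim p.1 p.2))).card))


noncomputable section Aux

abbrev EE (V : Type*) [Fintype V] [DecidableEq V] := EuclideanSpace ℝ (Finset V)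

variable {V : Type*} [Fintype V] [DecidableEq V]

def xx (v : V) (R : Finset V) : ℝ := if v ∈ R then 1 else 0

def gen (k : ℕ) {r : ℕ} (a b : Fin r → V) (s : Finset (Fin r)) (T : Finset V) : EE V :=
  WithLp.toLp 2 (fun R => if R.card = k then
    (∏ t ∈ T, xx t R) * ∏ i ∈ s, (xx (a i) R - xx (b i) R) else 0)

def mon (k : ℕ) (T : Finset V) : EE V :=
  WithLp.toLp 2 (fun R => if R.card = k then (∏ t ∈ T, xx t R) else 0)

def chi (k : ℕ) {r : ℕ} (a b : Fin r → V) : EE V :=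
  WithLp.toLp 2 (fun R => if R.card = k then ∏ i, (xx (a i) R - xx (b i) R) else 0)

lemma gen_empty (k : ℕ) {r : ℕ} (a b : Fin r → V) (T : Finset V) :
    gen k a b ∅ T = mon k T := by
  ext R; simp [gen, mon]

lemma gen_univ (k : ℕ) {r : ℕ} (a b : Fin r → V) :
    gen k a b univ ∅ = chi k a b := by
  ext R; simp [gen, chi]

def act (π : Equiv.Perm V) : EE V →ₗ[ℝ] EE V where
  toFun F := WithLp.toLp 2 (fun R => F (R.map π.symm.toEmbedding))
  map_add' F G := by ext R; simp
  map_smul' c F := by ext R; simp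

lemma act_apply (π : Equiv.Perm V) (F : EE V) (R : Finset V) :
    act π F R = F (R.map π.symm.toEmbedding) := rfl

lemma act_inner (π : Equiv.Perm V) (F G : EE V) :
    inner ℝ (act π F) (act π G) = inner ℝ F G := by
  simp only [PiLp.inner_apply, act_apply]
  exact (Equiv.finsetCongr π.symm).sum_comp (fun R => inner ℝ (F R) (G R))

lemma xx_map (π : Equiv.Perm V) (v : V) (R : Finset V) :
    xx v (R.map π.symm.toEmbedding) = xx (π v) R := by
  unfold xx
  congr 1
  simp [Equiv.symm_apply_eq]

lemma act_gen (π : Equiv.Perm V) (k : ℕ) {r : ℕ} (a b : Fin r → V) (s : Finset (Fin r))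
    (T : Finset V) :
    act π (gen k a b s T) = gen k (π ∘ a) (π ∘ b) s (T.map π.toEmbedding) := by
  ext R
  simp [act_apply, gen, xx_map]

lemma act_chi (π : Equiv.Perm V) (k : ℕ) {r : ℕ} (a b : Fin r → V) :
    act π (chi k a b) = chi k (π ∘ a) (π ∘ b) := by
  ext R
  simp [act_apply, chi, xx_map]

lemma act_mon (π : Equiv.Perm V) (k : ℕ) (T : Finset V) :
    act π (mon k T) = mon k (T.map π.toEmbedding) := by
  ext R
  simp [act_apply, mon, xx_map]

abbrev Inj {r : ℕ} (a b : Fin r → V) : Prop := Function.Injective (Sum.elim a b)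

lemma Inj.a {r : ℕ} {a b : Fin r → V} (h : Inj a b) {i j} (e : a i = a j) : i = j := by
  have := @h (Sum.inl i) (Sum.inl j) (by simpa using e)
  simpa using this
lemma Inj.b {r : ℕ} {a b : Fin r → V} (h : Inj a b) {i j} (e : b i = b j) : i = j := by
  have := @h (Sum.inr i) (Sum.inr j) (by simpa using e)
  simpa using this
lemma Inj.ab {r : ℕ} {a b : Fin r → V} (h : Inj a b) (i j) : a i ≠ b j := by
  intro e
  have := @h (Sum.inl i) (Sum.inr j) (by simpa using e)
  simp at this

lemma swap_fix_a {r : ℕ} {a b : Fin r → V} (h : Inj a b) {i j : Fin r} (hij : j ≠ i) :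
    Equiv.swap (a i) (b i) (a j) = a j :=
  Equiv.swap_apply_of_ne_of_ne (fun e => hij (h.a e)) (h.ab _ _)
lemma swap_fix_b {r : ℕ} {a b : Fin r → V} (h : Inj a b) {i j : Fin r} (hij : j ≠ i) :
    Equiv.swap (a i) (b i) (b j) = b j :=
  Equiv.swap_apply_of_ne_of_ne (fun e => h.ab _ _ e.symm) (fun e => hij (h.b e))

lemma act_swap_chi (k : ℕ) {r : ℕ} {a b : Fin r → V} (h : Inj a b) (i : Fin r) :
    act (Equiv.swap (a i) (b i)) (chi k a b) = - chi k a b := by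
  rw [act_chi]
  ext R
  simp only [chi, PiLp.neg_apply, Function.comp]
  split_ifs
  · rw [← Finset.mul_prod_erase _ _ (Finset.mem_univ i),
      ← Finset.mul_prod_erase _ _ (Finset.mem_univ i)]
    rw [Finset.prod_congr rfl (g := fun j => xx (a j) R - xx (b j) R)]
    · simp
      ring
    · intro j hj
      rw [swap_fix_a h (by simpa using hj), swap_fix_b h (by simpa using hj)]
  · simp

def Good {r : ℕ} (a b : Fin r → V) (s : Finset (Fin r)) (T : Finset V) : Prop :=
  T.card + s.card = r ∧ ∀ i ∈ s, a i ∉ T ∧ b i ∉ T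

def Mon (V : Type*) [Fintype V] [DecidableEq V] (k r : ℕ) : Submodule ℝ (EE V) :=
  Submodule.span ℝ (((powersetCard r (univ : Finset V)).image (mon k) : Finset (EE V)) : Set (EE V))

lemma mon_mem {k r : ℕ} {T : Finset V} (h : T.card = r) : mon k T ∈ Mon V k r := by
  apply Submodule.subset_span
  simp only [coe_image, Set.mem_image]
  exact ⟨T, by simpa using h, rfl⟩

lemma gen_insert (k : ℕ) {r : ℕ} (a b : Fin r → V) (s : Finset (Fin r)) (T : Finset V)
    (i : Fin r) (hi : i ∉ s) (ha : a i ∉ T) (hb : b i ∉ T) :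
    gen k a b (insert i s) T = gen k a b s (insert (a i) T) - gen k a b s (insert (b i) T) := by
  ext R
  simp only [gen, PiLp.sub_apply]
  rw [prod_insert hi, prod_insert ha, prod_insert hb]
  split_ifs <;> ring

lemma gen_mem (k : ℕ) {r : ℕ} {a b : Fin r → V} (h : Inj a b) (s : Finset (Fin r)) :
    ∀ T : Finset V, Good a b s T → gen k a b s T ∈ Mon V k r := by
  induction s using Finset.induction_on with
  | empty =>
    intro T hT
    rw [gen_empty]
    exact mon_mem (by simpa [Good] using hT)
  | insert i s hi ih =>
    intro T hT
    obtain ⟨h1, h2⟩ := hT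
    have hi' := h2 i (by simp)
    rw [gen_insert k a b s T i hi hi'.1 hi'.2]
    rw [card_insert_of_notMem hi] at h1
    apply Submodule.sub_mem
    · apply ih
      refine ⟨by rw [card_insert_of_notMem hi'.1]; omega, fun j hj => ?_⟩
      have := h2 j (by simp [hj])
      have hji : j ≠ i := by rintro rfl; exact hi hj
      simp only [mem_insert, not_or]
      exact ⟨⟨fun e => hji (h.a e), this.1⟩, ⟨fun e => h.ab _ _ e.symm, this.2⟩⟩
    · apply ih
      refine ⟨by rw [card_insert_of_notMem hi'.2]; omega, fun j hj => ?_⟩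
      have := h2 j (by simp [hj])
      have hji : j ≠ i := by rintro rfl; exact hi hj
      simp only [mem_insert, not_or]
      exact ⟨⟨fun e => h.ab _ _ e, this.1⟩, ⟨fun e => hji (h.b e), this.2⟩⟩

lemma chi_mem (k : ℕ) {r : ℕ} {a b : Fin r → V} (h : Inj a b) : chi k a b ∈ Mon V k r := by
  rw [← gen_univ]
  exact gen_mem k h _ _ (by simp [Good])

/-- span of the level `s` antisymmetrised generators -/
def GS (k : ℕ) {r : ℕ} (a b : Fin r → V) (s : Finset (Fin r)) : Submodule ℝ (EE V) :=
  Submodule.span ℝ {x | ∃ T, Good a b s T ∧ x = gen k a b s T}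

lemma act_swap_gen (k : ℕ) {r : ℕ} {a b : Fin r → V} (h : Inj a b) (s : Finset (Fin r))
    (T : Finset V) (i : Fin r) (hi : i ∉ s) :
    act (Equiv.swap (a i) (b i)) (gen k a b s T) =
      gen k a b s (T.map (Equiv.swap (a i) (b i)).toEmbedding) := by
  rw [act_gen]
  ext R
  simp only [gen, Function.comp]
  congr 2
  apply prod_congr rfl
  intro j hj
  have hji : j ≠ i := by rintro rfl; exact hi hj
  rw [swap_fix_a h hji, swap_fix_b h hji]

lemma map_swap_same (x y : V) (T : Finset V) (h : x ∈ T ↔ y ∈ T) :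
    T.map (Equiv.swap x y).toEmbedding = T := by
  ext z
  simp only [mem_map_equiv, Equiv.symm_swap]
  rcases eq_or_ne z x with rfl | h1
  · simp [h]
  rcases eq_or_ne z y with rfl | h2
  · simp [h]
  rw [Equiv.swap_apply_of_ne_of_ne h1 h2]

lemma map_swap_left (x y : V) (T : Finset V) (hx : x ∈ T) (hy : y ∉ T) :
    T.map (Equiv.swap x y).toEmbedding = insert y (T.erase x) := by
  ext z
  have hxy : x ≠ y := by rintro rfl; exact hy hx
  simp only [mem_map_equiv, Equiv.symm_swap, mem_insert, mem_erase]
  rcases eq_or_ne z x with rfl | h1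
  · simp [hy, hxy]
  rcases eq_or_ne z y with rfl | h2
  · simp [hx]
  rw [Equiv.swap_apply_of_ne_of_ne h1 h2]
  simp [h1, h2]

lemma diff_mem (k : ℕ) {r : ℕ} {a b : Fin r → V} (h : Inj a b) (s : Finset (Fin r))
    (T : Finset V) (hT : Good a b s T) (i : Fin r) (hi : i ∉ s) :
    gen k a b s T - act (Equiv.swap (a i) (b i)) (gen k a b s T) ∈ GS k a b (insert i s) := by
  rw [act_swap_gen k h s T i hi]
  obtain ⟨h1, h2⟩ := hT
  by_cases hx : a i ∈ T <;> by_cases hy : b i ∈ T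
  · rw [map_swap_same _ _ _ (by tauto)]; simp
  · rw [map_swap_left _ _ _ hx hy]
    have := gen_insert k a b s (T.erase (a i)) i hi (by simp) (by simp [hy])
    rw [insert_erase hx] at this
    rw [← this]
    apply Submodule.subset_span
    refine ⟨_, ⟨?_, ?_⟩, rfl⟩
    · rw [card_erase_of_mem hx, card_insert_of_notMem hi]
      have := card_pos.2 ⟨_, hx⟩
      omega
    · intro j hj
      rcases mem_insert.1 hj with rfl | hj
      · simp [hy]
      · have := h2 j hj
        simp [this]
  · rw [Equiv.swap_comm, map_swap_left _ _ _ hy hx]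
    have := gen_insert k a b s (T.erase (b i)) i hi (by simp [hx]) (by simp)
    rw [insert_erase hy] at this
    rw [← neg_sub, ← this]
    apply Submodule.neg_mem
    apply Submodule.subset_span
    refine ⟨_, ⟨?_, ?_⟩, rfl⟩
    · rw [card_erase_of_mem hy, card_insert_of_notMem hi]
      have := card_pos.2 ⟨_, hy⟩
      omega
    · intro j hj
      rcases mem_insert.1 hj with rfl | hj
      · simp [hx]
      · have := h2 j hj
        simp [this]
  · rw [map_swap_same _ _ _ (by tauto)]; simp

lemma antisym_GS (k : ℕ) {r : ℕ} {a b : Fin r → V} (h : Inj a b) (F : EE V)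
    (hF : F ∈ Mon V k r) (hs : ∀ i, act (Equiv.swap (a i) (b i)) F = - F) (s : Finset (Fin r)) :
    F ∈ GS k a b s := by
  induction s using Finset.induction_on with
  | empty =>
    refine Submodule.span_mono ?_ hF
    intro x hx
    simp only [coe_image, Set.mem_image, mem_coe, mem_powersetCard] at hx
    obtain ⟨T, hT, rfl⟩ := hx
    exact ⟨T, by simpa [Good] using hT.2, (gen_empty k a b T).symm⟩
  | insert i s hi ih =>
    have key : GS k a b s ≤ (GS k a b (insert i s)).comap
        (LinearMap.id - act (Equiv.swap (a i) (b i))) := by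
      apply Submodule.span_le.2
      rintro x ⟨T, hT, rfl⟩
      exact diff_mem k h s T hT i hi
    have := key ih
    simp only [Submodule.mem_comap, LinearMap.sub_apply, LinearMap.id_apply, hs,
      sub_neg_eq_add] at this
    have h2 := Submodule.smul_mem _ (1/2 : ℝ) this
    rw [← two_smul ℝ F, smul_smul] at h2
    simpa using h2

lemma antisym_chi (k : ℕ) {r : ℕ} {a b : Fin r → V} (h : Inj a b) (F : EE V)
    (hF : F ∈ Mon V k r) (hs : ∀ i, act (Equiv.swap (a i) (b i)) F = - F) :
    ∃ c : ℝ, F = c • chi k a b := by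
  have := antisym_GS k h F hF hs univ
  have h2 : GS k a b univ ≤ Submodule.span ℝ {chi k a b} := by
    apply Submodule.span_le.2
    rintro x ⟨T, hT, rfl⟩
    have : T = ∅ := by
      have := hT.1
      simp at this
      exact this
    subst this
    rw [gen_univ]
    exact Submodule.mem_span_singleton_self _
  obtain ⟨c, hc⟩ := Submodule.mem_span_singleton.1 (h2 this)
  exact ⟨c, hc.symm⟩

lemma mon_inner_chi (k : ℕ) {r : ℕ} {a b : Fin r → V} (h : Inj a b) (T : Finset V)
    (hT : T.card < r) : inner ℝ (mon k T) (chi k a b) = 0 := by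
  have : ∃ i, a i ∉ T ∧ b i ∉ T := by
    by_contra! hc
    have : Function.Injective (fun i => (if ha : a i ∈ T then ⟨a i, ha⟩ else ⟨b i, hc i ha⟩ : T)) := by
      intro i j hij
      have hij' := congrArg Subtype.val hij
      dsimp only at hij'
      split_ifs at hij'
      · exact h.a hij'
      · exact absurd hij' (h.ab _ _)
      · exact absurd hij'.symm (h.ab _ _)
      · exact h.b hij'
    have := Fintype.card_le_of_injective _ this
    simp at this
    omega
  obtain ⟨i, h1, h2⟩ := this
  have := act_inner (Equiv.swap (a i) (b i)) (mon k T) (chi k a b)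
  rw [act_swap_chi k h, act_mon, map_swap_same _ _ _ (by tauto), inner_neg_right] at this
  linarith

lemma Mon_inner_chi (k : ℕ) {r q : ℕ} {a b : Fin r → V} (h : Inj a b) (hq : q < r) (F : EE V)
    (hF : F ∈ Mon V k q) : inner ℝ F (chi k a b) = 0 := by
  induction hF using Submodule.span_induction with
  | mem x hx =>
    simp only [coe_image, Set.mem_image, mem_coe, mem_powersetCard] at hx
    obtain ⟨T, hT, rfl⟩ := hx
    exact mon_inner_chi k h T (by omega)
  | zero => simp
  | add x y _ _ hx hy => rw [inner_add_left, hx, hy, add_zero]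
  | smul c x _ hx => rw [inner_smul_left, hx, mul_zero]

def tup (V : Type*) [Fintype V] [DecidableEq V] (r : ℕ) : Finset ((Fin r → V) × (Fin r → V)) :=
  univ.filter (fun p => Function.Injective (Sum.elim p.1 p.2))

def Sp (V : Type*) [Fintype V] [DecidableEq V] (k r : ℕ) : Submodule ℝ (EE V) :=
  Submodule.span ℝ {x | ∃ p ∈ tup V r, x = chi k p.1 p.2}

lemma mem_tup {r : ℕ} {p : (Fin r → V) × (Fin r → V)} : p ∈ tup V r ↔ Inj p.1 p.2 := by
  simp [tup]

lemma Sp_le_Mon (k r : ℕ) : Sp V k r ≤ Mon V k r := by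
  apply Submodule.span_le.2
  rintro x ⟨p, hp, rfl⟩
  exact chi_mem k (mem_tup.1 hp)

lemma Sp_orth (k : ℕ) {q r : ℕ} (hq : q < r) (F G : EE V) (hF : F ∈ Sp V k q) (hG : G ∈ Sp V k r) :
    inner ℝ F G = 0 := by
  induction hG using Submodule.span_induction with
  | mem x hx =>
    obtain ⟨p, hp, rfl⟩ := hx
    exact Mon_inner_chi k (mem_tup.1 hp) hq F (Sp_le_Mon k q hF)
  | zero => simp
  | add x y _ _ hx hy => rw [inner_add_right, hx, hy, add_zero]
  | smul c x _ hx => rw [inner_smul_right, hx, mul_zero]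

lemma finrank_Sp (k r : ℕ) : Module.finrank ℝ (Sp V k r) ≤ (Fintype.card V).choose r := by
  refine (Submodule.finrank_mono (Sp_le_Mon k r)).trans ?_
  refine (finrank_span_finset_le_card _).trans ?_
  refine card_image_le.trans ?_
  simp

def Phi (k r : ℕ) : EE V →ₗ[ℝ] EE V where
  toFun g := ∑ p ∈ tup V r, (inner ℝ g (chi k p.1 p.2) : ℝ) • chi k p.1 p.2
  map_add' x y := by simp [inner_add_left, add_smul, sum_add_distrib]
  map_smul' c x := by simp [inner_smul_left, mul_smul, smul_sum]

lemma Phi_apply (k r : ℕ) (g : EE V) :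
    Phi k r g = ∑ p ∈ tup V r, (inner ℝ g (chi k p.1 p.2) : ℝ) • chi k p.1 p.2 := rfl

lemma sum_tup_perm {M : Type*} [AddCommMonoid M] (r : ℕ) (π : Equiv.Perm V)
    (φ : (Fin r → V) × (Fin r → V) → M) :
    ∑ p ∈ tup V r, φ (π ∘ p.1, π ∘ p.2) = ∑ p ∈ tup V r, φ p := by
  have hc : ∀ (σ : Equiv.Perm V) (a b : Fin r → V), Inj a b → Inj (σ ∘ a) (σ ∘ b) := by
    intro σ a b h
    unfold Inj
    rw [← Sum.comp_elim]
    exact σ.injective.comp h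
  refine sum_bij' (fun p _ => (π ∘ p.1, π ∘ p.2)) (fun p _ => (π.symm ∘ p.1, π.symm ∘ p.2))
    ?_ ?_ ?_ ?_ ?_
  · intro p hp; exact mem_tup.2 (hc _ _ _ (mem_tup.1 hp))
  · intro p hp; exact mem_tup.2 (hc _ _ _ (mem_tup.1 hp))
  · intro p hp; ext <;> simp
  · intro p hp; ext <;> simp
  · intro p hp; rfl

lemma act_Phi (k r : ℕ) (π : Equiv.Perm V) (g : EE V) :
    act π (Phi k r g) = Phi k r (act π g) := by
  rw [Phi_apply, Phi_apply, map_sum, ← sum_tup_perm r π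
    (fun p => (inner ℝ (act π g) (chi k p.1 p.2) : ℝ) • chi k p.1 p.2)]
  apply sum_congr rfl
  intro p _
  rw [map_smul, ← act_inner π g, act_chi]

lemma Phi_mem (k r : ℕ) (g : EE V) : Phi k r g ∈ Sp V k r := by
  apply Submodule.sum_mem
  intro p hp
  exact Submodule.smul_mem _ _ (Submodule.subset_span ⟨p, hp, rfl⟩)

lemma Phi_chi (k : ℕ) {r : ℕ} {a b : Fin r → V} (h : Inj a b) :
    ∃ c : ℝ, Phi k r (chi k a b) = c • chi k a b := by
  apply antisym_chi k h _ (Sp_le_Mon k r (Phi_mem k r _))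
  intro i
  rw [act_Phi, act_swap_chi k h, map_neg]

lemma exists_perm {r : ℕ} {a b c d : Fin r → V} (h : Inj a b) (h' : Inj c d) :
    ∃ π : Equiv.Perm V, π ∘ a = c ∧ π ∘ b = d := by
  classical
  let e : Set.range (Sum.elim a b) ≃ Set.range (Sum.elim c d) :=
    (Equiv.ofInjective _ h).symm.trans (Equiv.ofInjective _ h')
  have he : ∀ z, (e.extendSubtype (Sum.elim a b z)) = Sum.elim c d z := by
    intro z
    rw [Equiv.extendSubtype_apply_of_mem _ _ (Set.mem_range_self z)]
    simp only [e, Equiv.trans_apply]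
    rw [show (⟨Sum.elim a b z, Set.mem_range_self z⟩ : Set.range (Sum.elim a b)) =
      Equiv.ofInjective _ h z from rfl, Equiv.symm_apply_apply]
    rfl
  exact ⟨e.extendSubtype, funext fun i => he (Sum.inl i), funext fun i => he (Sum.inr i)⟩

lemma Phi_scalar (k r : ℕ) : ∃ μ : ℝ, ∀ g ∈ Sp V k r, Phi k r g = μ • g := by
  rcases (tup V r).eq_empty_or_nonempty with he | ⟨p0, hp0⟩
  · refine ⟨0, fun g _ => ?_⟩
    rw [Phi_apply, he]; simp
  · obtain ⟨μ, hμ⟩ := Phi_chi k (mem_tup.1 hp0)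
    refine ⟨μ, fun g hg => ?_⟩
    induction hg using Submodule.span_induction with
    | mem x hx =>
      obtain ⟨p, hp, rfl⟩ := hx
      obtain ⟨π, h1, h2⟩ := exists_perm (mem_tup.1 hp0) (mem_tup.1 hp)
      rw [← h1, ← h2, ← act_chi, ← act_Phi, hμ, map_smul]
    | zero => simp
    | add x y _ _ hx hy => rw [map_add, hx, hy, smul_add]
    | smul c x _ hx => rw [map_smul, hx, smul_comm]

lemma Phi_inner (k r : ℕ) (g : EE V) :
    inner ℝ (Phi k r g) g = ∑ p ∈ tup V r, (inner ℝ g (chi k p.1 p.2) : ℝ) ^ 2 := by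
  rw [Phi_apply, sum_inner]
  apply sum_congr rfl
  intro p _
  rw [inner_smul_left, real_inner_comm g]
  simp [sq]

lemma chi_norm_const (k : ℕ) {r : ℕ} {a b c d : Fin r → V} (h : Inj a b) (h' : Inj c d) :
    inner ℝ (chi k a b) (chi k a b) = (inner ℝ (chi k c d) (chi k c d) : ℝ) := by
  obtain ⟨π, rfl, rfl⟩ := exists_perm h h'
  rw [← act_chi, act_inner]

def Cr (k : ℕ) {r : ℕ} (a b : Fin r → V) : Finset (Finset V) :=
  (Finset.univ.powersetCard k).filter (fun R => ∀ i, (R ∩ {a i, b i}).card = 1)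

lemma cross_iff {x y : V} (hxy : x ≠ y) (R : Finset V) :
    (R ∩ {x, y}).card = 1 ↔ (x ∈ R ∧ y ∉ R) ∨ (x ∉ R ∧ y ∈ R) := by
  by_cases hx : x ∈ R <;> by_cases hy : y ∈ R
  · have : R ∩ {x, y} = {x, y} := by
      apply inter_eq_right.2
      intro z hz
      simp at hz
      rcases hz with rfl | rfl <;> assumption
    rw [this, card_pair hxy]
    simp [hx, hy]
  · have : R ∩ {x, y} = {x} := by
      ext z
      simp
      constructor
      · rintro ⟨h1, rfl | rfl⟩
        · rfl
        · exact absurd h1 hy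
      · rintro rfl; exact ⟨hx, Or.inl rfl⟩
    rw [this]
    simp [hx, hy]
  · have : R ∩ {x, y} = {y} := by
      ext z
      simp
      constructor
      · rintro ⟨h1, rfl | rfl⟩
        · exact absurd h1 hx
        · rfl
      · rintro rfl; exact ⟨hy, Or.inr rfl⟩
    rw [this]
    simp [hx, hy]
  · have : R ∩ {x, y} = ∅ := by
      ext z
      simp
      intro h1
      constructor <;> rintro rfl <;> contradiction
    rw [this]
    simp [hx, hy]

lemma chi_eq (k : ℕ) {r : ℕ} {a b : Fin r → V} (h : Inj a b) (R : Finset V) :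
    chi k a b R = if R ∈ Cr k a b then (-1 : ℝ) ^ (R ∩ Finset.image b Finset.univ).card else 0 := by
  simp only [chi, Cr, mem_filter, mem_powersetCard, subset_univ, true_and]
  by_cases hk : R.card = k
  swap
  · simp [hk]
  simp only [hk, true_and, if_true]
  split_ifs with hc
  · have h1 : ∀ i, xx (a i) R - xx (b i) R = if b i ∈ R then -1 else 1 := by
      intro i
      rcases (cross_iff (h.ab i i) R).1 (hc i) with ⟨h1, h2⟩ | ⟨h1, h2⟩ <;> simp [xx, h1, h2]
    rw [prod_congr rfl (fun i _ => h1 i)]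
    rw [← prod_filter, prod_const]
    congr 1
    have : R ∩ image b univ = (univ.filter (fun i => b i ∈ R)).image b := by
      ext z
      simp only [mem_inter, mem_image, mem_univ, true_and, mem_filter]
      constructor
      · rintro ⟨hz, i, rfl⟩; exact ⟨i, hz, rfl⟩
      · rintro ⟨i, hz, rfl⟩; exact ⟨hz, i, rfl⟩
    rw [this, card_image_of_injective]
    intro i j hij
    exact h.b hij
  · push Not at hc
    obtain ⟨i, hi⟩ := hc
    apply prod_eq_zero (mem_univ i)
    rw [Ne, cross_iff (h.ab i i)] at hi
    by_cases hx : a i ∈ R <;> by_cases hy : b i ∈ R <;> simp_all [xx]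

lemma inner_chi (k : ℕ) {r : ℕ} {a b : Fin r → V} (h : Inj a b) (f : Finset V → ℝ) :
    inner ℝ (WithLp.toLp 2 f : EE V) (chi k a b) =
      ∑ R ∈ Cr k a b, (-1 : ℝ) ^ (R ∩ Finset.image b Finset.univ).card * f R := by
  simp only [PiLp.inner_apply, chi_eq k h]
  simp [Finset.sum_ite_mem]

lemma chi_chi (k : ℕ) {r : ℕ} {a b : Fin r → V} (h : Inj a b) :
    inner ℝ (chi k a b) (chi k a b) = ((Cr k a b).card : ℝ) := by
  have := inner_chi k h (chi k a b)
  rw [show (WithLp.toLp 2 (chi k a b : Finset V → ℝ) : EE V) = chi k a b from rfl] at this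
  rw [this, card_eq_sum_ones, Nat.cast_sum]
  apply sum_congr rfl
  intro R hR
  rw [chi_eq k h, if_pos hR, ← mul_pow]
  simp

lemma signedAvg_eq (k : ℕ) {r : ℕ} {a b : Fin r → V} (h : Inj a b) (f : Finset V → ℝ) :
    signedAvg k f a b = inner ℝ (WithLp.toLp 2 f : EE V) (chi k a b) / ((Cr k a b).card : ℝ) := by
  rw [inner_chi k h]
  rfl

lemma Wpow_sq (k r : ℕ) (f : Finset V → ℝ) :
    ((tup V r).card : ℝ) * Wpow k r f ^ 2 = ∑ p ∈ tup V r, (signedAvg k f p.1 p.2) ^ 2 := by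
  have h0 : 0 ≤ ∑ p ∈ tup V r, (signedAvg k f p.1 p.2) ^ 2 := sum_nonneg fun _ _ => sq_nonneg _
  have : Wpow k r f = Real.sqrt ((∑ p ∈ tup V r, (signedAvg k f p.1 p.2) ^ 2) / (tup V r).card) := rfl
  rw [this, Real.sq_sqrt (by positivity)]
  rcases (tup V r).eq_empty_or_nonempty with he | hne
  · rw [he]; simp
  · have : ((tup V r).card : ℝ) ≠ 0 := by
      exact_mod_cast (card_pos.2 hne).ne'
    field_simp

lemma card_Cr_le (k : ℕ) {r : ℕ} {a b : Fin r → V} (h : Inj a b) :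
    (Cr k a b).card ≤ 2 ^ r * (Fintype.card V - 2 * r).choose (k - r) := by
  classical
  set U : Finset V := univ.image (Sum.elim a b) with hU
  have hUc : U.card = 2 * r := by
    rw [hU, card_image_of_injective _ h]; simp; ring
  have ha : ∀ i, a i ∈ U := fun i => mem_image.2 ⟨Sum.inl i, by simp, rfl⟩
  have hb : ∀ i, b i ∈ U := fun i => mem_image.2 ⟨Sum.inr i, by simp, rfl⟩
  have key : (Cr k a b).card ≤
      ((univ : Finset (Finset (Fin r))) ×ˢ powersetCard (k - r) (univ \ U)).card := by
    apply card_le_card_of_injOn (fun R => (univ.filter (fun i => a i ∈ R), R \ U))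
    · intro R hR
      simp only [Cr, coe_filter, mem_powersetCard, subset_univ, true_and, Set.mem_setOf_eq] at hR
      obtain ⟨hk, hc⟩ := hR
      simp only [coe_product, Set.mem_prod, mem_coe, mem_univ, mem_powersetCard, true_and]
      refine ⟨sdiff_subset_sdiff (subset_univ _) le_rfl, ?_⟩
      have h1 : (R ∩ U).card = r := by
        have : R ∩ U = univ.image (fun i => if a i ∈ R then a i else b i) := by
          ext z
          simp only [mem_inter, hU, mem_image, mem_univ, true_and, Sum.exists, Sum.elim_inl,
            Sum.elim_inr]
          constructor
          · rintro ⟨hz, ⟨i, rfl⟩ | ⟨i, rfl⟩⟩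
            · exact ⟨i, by simp [hz]⟩
            · refine ⟨i, ?_⟩
              rcases (cross_iff (h.ab i i) R).1 (hc i) with ⟨h1, h2⟩ | ⟨h1, h2⟩
              · exact absurd hz h2
              · simp [h1]
          · rintro ⟨i, rfl⟩
            rcases (cross_iff (h.ab i i) R).1 (hc i) with ⟨h1, h2⟩ | ⟨h1, h2⟩
            · simp [h1]
            · simp [h1, h2]
        rw [this, card_image_of_injective]
        · simp
        · intro i j hij
          dsimp only at hij
          split_ifs at hij
          · exact h.a hij
          · exact absurd hij (h.ab _ _)
          · exact absurd hij.symm (h.ab _ _)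
          · exact h.b hij
      have := card_sdiff_add_card_inter R U
      omega
    · intro R hR R' hR' heq
      simp only [Cr, coe_filter, mem_powersetCard, subset_univ, true_and, Set.mem_setOf_eq] at hR hR'
      simp only [Prod.mk.injEq] at heq
      obtain ⟨e1, e2⟩ := heq
      have ea : ∀ i, a i ∈ R ↔ a i ∈ R' := fun i => by
        have := Finset.ext_iff.1 e1 i
        simpa using this
      ext z
      by_cases hz : z ∈ U
      · obtain ⟨w, -, rfl⟩ := mem_image.1 hz
        rcases w with i | i
        · exact ea i
        · have h1 := (cross_iff (h.ab i i) R).1 (hR.2 i)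
          have h2 := (cross_iff (h.ab i i) R').1 (hR'.2 i)
          have := ea i
          simp only [Sum.elim_inr]
          tauto
      · have := Finset.ext_iff.1 e2 z
        simpa [hz] using this
  refine key.trans (le_of_eq ?_)
  rw [card_product, card_powersetCard, card_sdiff_of_subset (subset_univ _), hUc]
  simp

lemma trace_eq (k r : ℕ) (μ N : ℝ) (hμ : ∀ g ∈ Sp V k r, Phi k r g = μ • g)
    (hN : ∀ p ∈ tup V r, inner ℝ (chi k p.1 p.2) (chi k p.1 p.2) = N) :
    (Module.finrank ℝ (Sp V k r) : ℝ) * μ = ((tup V r).card : ℝ) * N := by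
  let e := stdOrthonormalBasis ℝ (Sp V k r)
  have h1 : ∑ i, ∑ p ∈ tup V r, (inner ℝ (e i : EE V) (chi k p.1 p.2) : ℝ) ^ 2 =
      (Module.finrank ℝ (Sp V k r) : ℝ) * μ := by
    have : ∀ i, ∑ p ∈ tup V r, (inner ℝ (e i : EE V) (chi k p.1 p.2) : ℝ) ^ 2 = μ := by
      intro i
      rw [← Phi_inner, hμ _ (e i).2, inner_smul_left]
      have : inner ℝ (e i : EE V) (e i : EE V) = (1 : ℝ) := by
        rw [← Submodule.coe_inner, real_inner_self_eq_norm_sq, e.orthonormal.1 i]; norm_num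
      rw [this]; simp
    rw [sum_congr rfl (fun i _ => this i)]
    simp
  rw [← h1, sum_comm]
  have : ∀ p ∈ tup V r, ∑ i, (inner ℝ (e i : EE V) (chi k p.1 p.2) : ℝ) ^ 2 = N := by
    intro p hp
    let x : Sp V k r := ⟨chi k p.1 p.2, Submodule.subset_span ⟨p, hp, rfl⟩⟩
    have h2 := e.sum_sq_norm_inner_right x
    have h3 : ‖x‖ ^ 2 = N := by
      rw [← hN p hp, ← real_inner_self_eq_norm_sq]; rfl
    rw [h3] at h2
    rw [← h2]
    apply sum_congr rfl
    intro i _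
    rw [Real.norm_eq_abs, sq_abs]
    rfl
  rw [sum_congr rfl this]
  simp

lemma level_bound (k r : ℕ) (hr : r ≤ k) (hk : 2 * k ≤ Fintype.card V) (f : Finset V → ℝ) :
    ‖(Sp V k r).starProjection (WithLp.toLp 2 f)‖ ^ 2 ≤
      (2 ^ r * k.choose r : ℝ) * (Fintype.card V).choose k * Wpow k r f ^ 2 := by
  set g := (Sp V k r).starProjection (WithLp.toLp 2 f) with hg
  have hgm : g ∈ Sp V k r := Submodule.starProjection_apply_mem _ _
  by_cases hex : ∃ p ∈ tup V r, chi k p.1 p.2 ≠ 0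
  swap
  · push Not at hex
    have : Sp V k r ≤ ⊥ := by
      apply Submodule.span_le.2
      rintro x ⟨p, hp, rfl⟩
      simp [hex p hp]
    have : g = 0 := by simpa using this hgm
    rw [this]
    simp
    positivity
  obtain ⟨p0, hp0, hne⟩ := hex
  obtain ⟨μ, hμ⟩ := Phi_scalar (V := V) k r
  set N : ℝ := inner ℝ (chi k p0.1 p0.2) (chi k p0.1 p0.2) with hNdef
  have hN : ∀ p ∈ tup V r, inner ℝ (chi k p.1 p.2) (chi k p.1 p.2) = N := fun p hp =>
    chi_norm_const k (mem_tup.1 hp) (mem_tup.1 hp0)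
  have hNpos : 0 < N := real_inner_self_pos.2 hne
  have htr := trace_eq k r μ N hμ hN
  have hT : 0 < ((tup V r).card : ℝ) := by exact_mod_cast card_pos.2 ⟨_, hp0⟩
  have h1 : μ * ‖g‖ ^ 2 = N ^ 2 * (((tup V r).card : ℝ) * Wpow k r f ^ 2) := by
    have := Phi_inner k r g
    rw [hμ g hgm, inner_smul_left, real_inner_self_eq_norm_sq] at this
    simp only [conj_trivial] at this
    rw [this, Wpow_sq, mul_sum]
    apply sum_congr rfl
    intro p hp
    have hf : inner ℝ g (chi k p.1 p.2) = (inner ℝ (WithLp.toLp 2 f : EE V) (chi k p.1 p.2) : ℝ) := by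
      have := Submodule.starProjection_inner_eq_zero (K := Sp V k r) (WithLp.toLp 2 f)
        (chi k p.1 p.2) (Submodule.subset_span ⟨p, hp, rfl⟩)
      rw [inner_sub_left] at this
      rw [hg]
      linarith
    rw [signedAvg_eq k (mem_tup.1 hp), ← chi_chi k (mem_tup.1 hp), hN p hp, hf]
    field_simp
  set d : ℝ := (Module.finrank ℝ (Sp V k r) : ℝ) with hd
  have h2 : ‖g‖ ^ 2 = d * N * Wpow k r f ^ 2 := by
    have : ‖g‖ ^ 2 * ((tup V r).card * N) = (d * N * Wpow k r f ^ 2) * ((tup V r).card * N) := by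
      rw [← htr]
      calc _ = d * (μ * ‖g‖ ^ 2) := by ring
        _ = d * N * Wpow k r f ^ 2 * ((tup V r).card * N) := by rw [h1]; ring
        _ = _ := by rw [← htr]
    exact mul_right_cancel₀ (by positivity) this
  rw [h2]
  apply mul_le_mul_of_nonneg_right _ (sq_nonneg _)
  have h3 : N = ((Cr k p0.1 p0.2).card : ℝ) := chi_chi k (mem_tup.1 hp0)
  have h4 := card_Cr_le k (mem_tup.1 hp0)
  have h5 := finrank_Sp (V := V) k r
  rw [h3, hd]
  have h6 : Module.finrank ℝ (Sp V k r) * (Cr k p0.1 p0.2).card ≤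
      2 ^ r * k.choose r * (Fintype.card V).choose k := by
    calc _ ≤ (Fintype.card V).choose r * (2 ^ r * (Fintype.card V - 2 * r).choose (k - r)) :=
          Nat.mul_le_mul h5 h4
      _ ≤ (Fintype.card V).choose r * (2 ^ r * (Fintype.card V - r).choose (k - r)) := by
          gcongr
          omega
      _ = 2 ^ r * ((Fintype.card V).choose k * k.choose r) := by
          rw [Nat.choose_mul hr]; ring
      _ = _ := by ring
  exact_mod_cast h6

lemma sum_bound (k ℓ : ℕ) (hk : 2 * k ≤ Fintype.card V) (f : Finset V → ℝ) (ε : ℝ)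
    (hf : ∀ r : ℕ, ℓ ≤ r → r ≤ k → Wpow k r f ≤ ε) :
    ‖∑ r ∈ Icc ℓ k, (Sp V k r).starProjection (WithLp.toLp 2 f)‖ ^ 2 ≤
      5 ^ k * ε ^ 2 * (Fintype.card V).choose k := by
  have horth : ∀ q r, q ≠ r → inner ℝ ((Sp V k q).starProjection (WithLp.toLp 2 f))
      ((Sp V k r).starProjection (WithLp.toLp 2 f)) = (0 : ℝ) := by
    intro q r hqr
    rcases lt_or_gt_of_ne hqr with h | h
    · exact Sp_orth k h _ _ (Submodule.starProjection_apply_mem _ _)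
        (Submodule.starProjection_apply_mem _ _)
    · rw [real_inner_comm]
      exact Sp_orth k h _ _ (Submodule.starProjection_apply_mem _ _)
        (Submodule.starProjection_apply_mem _ _)
  rw [← real_inner_self_eq_norm_sq, sum_inner]
  have h1 : ∀ q ∈ Icc ℓ k, inner ℝ ((Sp V k q).starProjection (WithLp.toLp 2 f))
      (∑ r ∈ Icc ℓ k, (Sp V k r).starProjection (WithLp.toLp 2 f)) ≤
      ((2 ^ q * k.choose q : ℝ)) * ((Fintype.card V).choose k * ε ^ 2) := by
    intro q hq
    rw [inner_sum, sum_eq_single_of_mem q hq (fun r _ hr => horth q r hr.symm),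
      real_inner_self_eq_norm_sq]
    rw [mem_Icc] at hq
    refine (level_bound k q hq.2 hk f).trans ?_
    rw [mul_assoc]
    have : 0 ≤ Wpow k q f := Real.sqrt_nonneg _
    have h2 := hf q hq.1 hq.2
    gcongr
  refine (sum_le_sum h1).trans ?_
  rw [← sum_mul]
  have h3 : ∑ q ∈ Icc ℓ k, (2 ^ q * k.choose q : ℝ) ≤ 5 ^ k := by
    calc _ ≤ ∑ q ∈ range (k + 1), (2 ^ q * k.choose q : ℝ) := by
          apply sum_le_sum_of_subset_of_nonneg
          · intro q hq
            simp only [mem_Icc, mem_range] at hq ⊢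
            omega
          · intros; positivity
      _ = (2 + 1 : ℝ) ^ k := by rw [add_pow]; simp
      _ ≤ 5 ^ k := by gcongr; norm_num
  calc _ ≤ 5 ^ k * ((Fintype.card V).choose k * ε ^ 2) := by gcongr
    _ = _ := by ring

end Aux

theorem stmt8 {V : Type*} [Fintype V] [DecidableEq V] (k ℓ : ℕ) (ε : ℝ)
    (hε : 0 < ε) (hℓ : 1 ≤ ℓ) (hlk : 2 * ℓ ≤ 2 * k) (hkV : 2 * k ≤ Fintype.card V)
    (f : Finset V → ℝ)
    (hf : ∀ r : ℕ, ℓ ≤ r → r ≤ k → Wpow k r f ≤ ε) :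
    ∃ ft : Finset V → ℝ,
      (((((Finset.univ : Finset V).powersetCard k).filter
          (fun R => ¬ |f R - ft R| ≤ Real.sqrt ε)).card : ℝ) ≤
        (5 : ℝ) ^ ((k : ℝ) / 2) * Real.sqrt ε * ((Fintype.card V).choose k : ℝ)) ∧
      (∀ r : ℕ, ℓ ≤ r → r ≤ k → Wpow k r ft = 0) := by
  set g : EE V := ∑ r ∈ Icc ℓ k, (Sp V k r).starProjection (WithLp.toLp 2 f) with hg
  have hbound := sum_bound k ℓ hkV f ε hf
  rw [← hg] at hbound
  refine ⟨fun R => f R - g R, ?_, ?_⟩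
  · set B := ((Finset.univ : Finset V).powersetCard k).filter
      (fun R => ¬ |f R - (f R - g R)| ≤ Real.sqrt ε) with hB
    have h1 : (B.card : ℝ) * ε ≤ ‖g‖ ^ 2 := by
      rw [EuclideanSpace.norm_sq_eq]
      calc (B.card : ℝ) * ε = ∑ R ∈ B, ε := by simp
        _ ≤ ∑ R ∈ B, ‖g R‖ ^ 2 := by
          apply sum_le_sum
          intro R hR
          rw [hB, mem_filter] at hR
          have h2 := hR.2
          rw [sub_sub_cancel, not_le] at h2
          rw [Real.norm_eq_abs, ← Real.sq_sqrt hε.le]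
          gcongr
        _ ≤ _ := sum_le_sum_of_subset_of_nonneg (subset_univ _) (fun _ _ _ => by positivity)
    set C : ℝ := ((Fintype.card V).choose k : ℝ) with hC
    have hC0 : 0 ≤ C := by positivity
    have h2 : (B.card : ℝ) ≤ C := by
      rw [hC]
      have : B.card ≤ _ := card_filter_le _ _
      rw [card_powersetCard, card_univ] at this
      exact_mod_cast this
    have h3 : (B.card : ℝ) ≤ 5 ^ k * ε * C := by
      have : (B.card : ℝ) * ε ≤ (5 ^ k * ε * C) * ε := by
        refine (h1.trans hbound).trans (le_of_eq (by ring))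
      exact le_of_mul_le_mul_right this hε
    have h5 : (0 : ℝ) ≤ (5 : ℝ) ^ ((k : ℝ) / 2) * Real.sqrt ε * C := by positivity
    apply le_of_sq_le_sq _ h5
    have h6 : ((5 : ℝ) ^ ((k : ℝ) / 2)) ^ 2 = 5 ^ k := by
      rw [← Real.rpow_natCast, ← Real.rpow_mul (by norm_num)]
      simp
    rw [mul_pow, mul_pow, h6, Real.sq_sqrt hε.le]
    calc (B.card : ℝ) ^ 2 = B.card * B.card := by ring
      _ ≤ (5 ^ k * ε * C) * C := mul_le_mul h3 h2 (by positivity) (by positivity)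
      _ = _ := by ring
  · intro r hr1 hr2
    have hz : ∀ p ∈ tup V r, signedAvg k (fun R => f R - g R) p.1 p.2 ^ 2 = 0 := by
      intro p hp
      have hpS : chi k p.1 p.2 ∈ Sp V k r := Submodule.subset_span ⟨p, hp, rfl⟩
      rw [signedAvg_eq k (mem_tup.1 hp)]
      have : (WithLp.toLp 2 (fun R => f R - g R) : EE V) = WithLp.toLp 2 f - g := by
        ext R; simp
      rw [this, inner_sub_left, hg, sum_inner,
        sum_eq_single_of_mem r (mem_Icc.2 ⟨hr1, hr2⟩)]
      · rw [← inner_sub_left, Submodule.starProjection_inner_eq_zero _ _ hpS]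
        simp
      · intro q _ hqr
        rcases lt_or_gt_of_ne hqr with h | h
        · exact Sp_orth k h _ _ (Submodule.starProjection_apply_mem _ _) hpS
        · rw [real_inner_comm]
          exact Sp_orth k h _ _ hpS (Submodule.starProjection_apply_mem _ _)
    have : Wpow k r (fun R => f R - g R) = Real.sqrt
      ((∑ p ∈ tup V r, (signedAvg k (fun R => f R - g R) p.1 p.2) ^ 2) / (tup V r).card) := rfl
    rw [this, sum_eq_zero hz]
    simp
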